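/- (Persistence when the principal eigenvalue is positive.) Assume (H1) and (H2), and let c≥0. Suppose λ>0 and φ:ℝ→(0,∞) is a bounded C¹ function satisfying c φ'(ξ)+∫_ℝ k(η−ξ) φ(η) dη − φ(ξ) + f(ξ,0) φ(ξ) = λ φ(ξ) for all ξ∈ℝ. Then: (a) there exists a bounded positive traveling-wave profile, i.e. a bounded C¹ function Φ:ℝ→(0,∞) with c Φ'(ξ)+∫_ℝ k(η−ξ) Φ(η) dη − Φ(ξ) + f(ξ,Φ(ξ)) Φ(ξ)=0 for all ξ∈ℝ; and (b) there exists α₀>0 such that for every α∈(0,α₀] and every bounded classical solution v of (E) on [0,∞) with v(0,ξ)=α φ(ξ) for all ξ, one has v(t,ξ) ≥ α φ(ξ) for all t≥0 and all ξ∈ℝ. -/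

import Mathlib

open MeasureTheory Real Set Filter Topology

noncomputable section

/-- Hypothesis (H1) on the kernel `k`. -/
def H1 (k : ℝ → ℝ) : Prop :=
  ContDiff ℝ 1 k ∧ (∀ z, 0 ≤ k z) ∧ (∀ z, k (-z) = k z) ∧
  (∫ z, k z) = 1 ∧ 0 < k 0 ∧
  ∃ μ M : ℝ, 0 < μ ∧ 0 < M ∧ ∀ z, M < |z| →
    k z < Real.exp (-(μ * |z|)) ∧ |deriv k z| < Real.exp (-(μ * |z|))

/-- Hypothesis (EXP): all exponential moments of `k` are finite. -/
def EXPk (k : ℝ → ℝ) : Prop :=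
  ∀ μ : ℝ, MeasureTheory.Integrable (fun z => Real.exp (μ * z) * k z)

/-- Hypothesis (H2) on the cut-off function `χ`. -/
def IsH2chi (r q L L0 : ℝ) (χ : ℝ → ℝ) : Prop :=
  0 < r ∧ 0 < q ∧ 0 < L ∧ 0 < L0 ∧
  ContDiff ℝ 1 χ ∧ (∀ x, χ x ∈ Set.Icc (0:ℝ) 1) ∧
  (∀ x, χ (-x) = χ x) ∧ (∀ x, |x| ≤ L → χ x = 1) ∧
  (∀ x, L + L0 ≤ |x| → χ x = 0) ∧ AntitoneOn χ (Set.Ici 0)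

/-- The growth function of hypothesis (H2). -/
def fH2 (r q : ℝ) (χ : ℝ → ℝ) : ℝ → ℝ → ℝ :=
  fun x u => -q + (r * (1 - u) + q) * χ x

/-- A bounded positive traveling-wave profile for speed `c`, kernel `k`, growth `f`. -/
def IsTW (c : ℝ) (k : ℝ → ℝ) (f : ℝ → ℝ → ℝ) (Φ : ℝ → ℝ) : Prop :=
  ContDiff ℝ 1 Φ ∧ (∀ ξ, 0 < Φ ξ) ∧ (∃ C, ∀ ξ, Φ ξ ≤ C) ∧
  ∀ ξ, c * deriv Φ ξ + ((∫ η, k (η - ξ) * Φ η) - Φ ξ) + f ξ (Φ ξ) * Φ ξ = 0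

/-- A bounded classical solution of equation (E) on `[0,∞) × ℝ`, with partial
derivatives `vt` (in time) and `vx` (in space). -/
def IsClassicalSol (c : ℝ) (k : ℝ → ℝ) (f : ℝ → ℝ → ℝ) (v vt vx : ℝ → ℝ → ℝ) : Prop :=
  (∃ C, ∀ t ξ, 0 ≤ t → |v t ξ| ≤ C) ∧
  ContinuousOn (fun p : ℝ × ℝ => v p.1 p.2) {p : ℝ × ℝ | 0 ≤ p.1} ∧
  ContinuousOn (fun p : ℝ × ℝ => vt p.1 p.2) {p : ℝ × ℝ | 0 ≤ p.1} ∧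
  ContinuousOn (fun p : ℝ × ℝ => vx p.1 p.2) {p : ℝ × ℝ | 0 ≤ p.1} ∧
  (∀ t ξ, 0 ≤ t → HasDerivWithinAt (fun s => v s ξ) (vt t ξ) (Set.Ici 0) t) ∧
  (∀ t ξ, 0 ≤ t → HasDerivAt (fun y => v t y) (vx t ξ) ξ) ∧
  (∀ t ξ, 0 ≤ t →
    vt t ξ = c * vx t ξ + ((∫ η, k (η - ξ) * v t η) - v t ξ) + f ξ (v t ξ) * v t ξ)

/-- The spreading speed `c*` of the homogeneous equation with growth rate `r`. -/
def cstar (k : ℝ → ℝ) (r : ℝ) : ℝ :=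
  sInf {y : ℝ | ∃ μ : ℝ, 0 < μ ∧ y = ((∫ z, Real.exp (-(μ * z)) * k z) - 1 + r) / μ}


lemma env_shift {μ : ℝ} (hμ : 0 < μ) {a b : ℝ} (h : |a - b| ≤ 1) (η : ℝ) :
    Real.exp (-(μ * |η - a|)) ≤ Real.exp μ * Real.exp (-(μ * |η - b|)) := by
  rw [← Real.exp_add]
  apply Real.exp_le_exp.2
  have h1 : |η - b| ≤ |η - a| + |a - b| := by
    have := abs_add_le (η - a) (a - b)
    simpa using this
  nlinarith

lemma env_integrable {μ : ℝ} (hμ : 0 < μ) :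
    Integrable (fun z : ℝ => Real.exp (-(μ * |z|))) := by
  by_contra h
  have h0 := integral_undef h
  rw [integral_comp_abs (f := fun z => Real.exp (-(μ * z)))] at h0
  have h1 := integral_exp_mul_Ioi (a := -μ) (by linarith) 0
  simp only [neg_mul] at h1
  rw [h1] at h0
  simp at h0
  exact hμ.ne' h0

lemma k_env {k : ℝ → ℝ} (hk : H1 k) : ∃ μ C : ℝ, 0 < μ ∧ 0 < C ∧
    ∀ z, k z ≤ C * Real.exp (-(μ * |z|)) ∧ |deriv k z| ≤ C * Real.exp (-(μ * |z|)) := by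
  obtain ⟨hC, hpos, _, _, _, μ, M, hμ, hM, hb⟩ := hk
  have hdc : Continuous (deriv k) := hC.continuous_deriv le_rfl
  obtain ⟨C1, h1⟩ := (isCompact_Icc (a := -M) (b := M)).exists_bound_of_continuousOn
    hC.continuous.continuousOn
  obtain ⟨C2, h2⟩ := (isCompact_Icc (a := -M) (b := M)).exists_bound_of_continuousOn
    hdc.continuousOn
  set D := max 1 (max C1 C2) with hD
  have hD1 : 1 ≤ D := le_max_left _ _
  have hDC1 : C1 ≤ D := (le_max_left _ _).trans (le_max_right _ _)
  have hDC2 : C2 ≤ D := (le_max_right _ _).trans (le_max_right _ _)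
  refine ⟨μ, D * Real.exp (μ * M), hμ, by positivity, fun z => ?_⟩
  have hE : 1 ≤ Real.exp (μ * M) := Real.one_le_exp (by positivity)
  by_cases hz : M < |z|
  · obtain ⟨ha, hb'⟩ := hb z hz
    have : Real.exp (-(μ * |z|)) ≤ D * Real.exp (μ * M) * Real.exp (-(μ * |z|)) := by
      apply le_mul_of_one_le_left (Real.exp_pos _).le
      nlinarith
    exact ⟨ha.le.trans this, hb'.le.trans this⟩
  · have hz' : |z| ≤ M := not_lt.1 hz
    have hzI : z ∈ Icc (-M) M := abs_le.1 hz'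
    have : D ≤ D * Real.exp (μ * M) * Real.exp (-(μ * |z|)) := by
      rw [mul_assoc, ← Real.exp_add]
      apply le_mul_of_one_le_right (by linarith)
      apply Real.one_le_exp
      nlinarith
    have a1 := h1 z hzI
    have a2 := h2 z hzI
    rw [Real.norm_eq_abs] at a1 a2
    exact ⟨(le_abs_self _).trans (a1.trans (hDC1.trans this)), a2.trans (hDC2.trans this)⟩

lemma k_int {k : ℝ → ℝ} (hk : H1 k) : Integrable k := by
  by_contra h
  have := integral_undef h
  rw [hk.2.2.2.1] at this
  norm_num at this

lemma k_int_shift {k : ℝ → ℝ} (hk : H1 k) (ξ : ℝ) : Integrable (fun η => k (η - ξ)) :=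
  (k_int hk).comp_sub_right ξ

lemma k_one {k : ℝ → ℝ} (hk : H1 k) (ξ : ℝ) : ∫ η, k (η - ξ) = 1 := by
  rw [integral_sub_right_eq_self (fun z => k z) ξ]; exact hk.2.2.2.1

lemma k_mul_int {k : ℝ → ℝ} (hk : H1 k) {φ : ℝ → ℝ} (hφ : Measurable φ) {B : ℝ}
    (hB : ∀ x, |φ x| ≤ B) (ξ : ℝ) : Integrable (fun η => k (η - ξ) * φ η) :=
  (k_int_shift hk ξ).mul_bdd (c := B) hφ.aestronglyMeasurable (ae_of_all _ hB)

lemma K_hasDerivAt {k : ℝ → ℝ} (hk : H1 k) {φ : ℝ → ℝ} (hφ : Measurable φ) {B : ℝ}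
    (hB : ∀ x, |φ x| ≤ B) (ξ : ℝ) :
    HasDerivAt (fun ξ => ∫ η, k (η - ξ) * φ η) (∫ η, (-deriv k (η - ξ)) * φ η) ξ := by
  obtain ⟨μ, C, hμ, hC, he⟩ := k_env hk
  have hdc : Continuous (deriv k) := hk.1.continuous_deriv le_rfl
  refine (hasDerivAt_integral_of_dominated_loc_of_deriv_le
    (F := fun ξ η => k (η - ξ) * φ η) (F' := fun ξ η => (-deriv k (η - ξ)) * φ η)
    (bound := fun η => C * Real.exp μ * B * Real.exp (-(μ * |η - ξ|)))
    (Metric.closedBall_mem_nhds ξ one_pos) ?_ (k_mul_int hk hφ hB ξ) ?_ ?_ ?_ ?_).2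
  · exact Eventually.of_forall fun x => (k_mul_int hk hφ hB x).aestronglyMeasurable
  · exact (((hdc.comp (continuous_id.sub continuous_const)).neg.measurable).mul
      hφ).aestronglyMeasurable
  · refine ae_of_all _ fun η x hx => ?_
    rw [Metric.mem_closedBall, Real.dist_eq] at hx
    rw [norm_mul, norm_neg, Real.norm_eq_abs, Real.norm_eq_abs]
    have h1 := (he (η - x)).2
    have h2 := env_shift hμ hx η
    calc _ ≤ (C * Real.exp (-(μ * |η - x|))) * B := by
          gcongr
          · exact hB η
      _ ≤ (C * (Real.exp μ * Real.exp (-(μ * |η - ξ|)))) * B := by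
          have : 0 ≤ B := (abs_nonneg _).trans (hB 0)
          gcongr
      _ = _ := by ring
  · exact ((env_integrable hμ).comp_sub_right ξ).const_mul _
  · refine ae_of_all _ fun η x _ => ?_
    have h1 : HasDerivAt k (deriv k (η - x)) (η - x) :=
      ((hk.1.differentiable one_ne_zero) _).hasDerivAt
    have h2 : HasDerivAt (fun x => η - x) (-1) x := by
      simpa using (hasDerivAt_id x).const_sub η
    have := (h1.comp x h2).mul_const (φ η)
    simpa using this

lemma K_deriv_cont {k : ℝ → ℝ} (hk : H1 k) {φ : ℝ → ℝ} (hφ : Measurable φ) {B : ℝ}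
    (hB : ∀ x, |φ x| ≤ B) :
    Continuous (fun ξ => ∫ η, (-deriv k (η - ξ)) * φ η) := by
  obtain ⟨μ, C, hμ, hC, he⟩ := k_env hk
  have hdc : Continuous (deriv k) := hk.1.continuous_deriv le_rfl
  rw [continuous_iff_continuousAt]
  intro ξ
  refine MeasureTheory.continuousAt_of_dominated
    (bound := fun η => C * Real.exp μ * B * Real.exp (-(μ * |η - ξ|))) ?_ ?_ ?_ ?_
  · exact Eventually.of_forall fun x => (((hdc.comp (continuous_id.sub
      continuous_const)).neg.measurable).mul hφ).aestronglyMeasurable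
  · filter_upwards [Metric.closedBall_mem_nhds ξ one_pos] with x hx
    refine ae_of_all _ fun η => ?_
    rw [Metric.mem_closedBall, Real.dist_eq] at hx
    rw [norm_mul, norm_neg, Real.norm_eq_abs, Real.norm_eq_abs]
    have h1 := (he (η - x)).2
    have h2 := env_shift hμ hx η
    calc _ ≤ (C * Real.exp (-(μ * |η - x|))) * B := by
          gcongr
          · exact hB η
      _ ≤ (C * (Real.exp μ * Real.exp (-(μ * |η - ξ|)))) * B := by
          have : 0 ≤ B := (abs_nonneg _).trans (hB 0)
          gcongr
      _ = _ := by ring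
  · exact ((env_integrable hμ).comp_sub_right ξ).const_mul _
  · refine ae_of_all _ fun η => ?_
    exact (((hdc.comp (continuous_const.sub continuous_id)).neg).mul
      continuous_const).continuousAt

lemma K_contDiff {k : ℝ → ℝ} (hk : H1 k) {φ : ℝ → ℝ} (hφ : Measurable φ) {B : ℝ}
    (hB : ∀ x, |φ x| ≤ B) : ContDiff ℝ 1 (fun ξ => ∫ η, k (η - ξ) * φ η) := by
  rw [contDiff_one_iff_deriv]
  refine ⟨fun ξ => (K_hasDerivAt hk hφ hB ξ).differentiableAt, ?_⟩
  rw [show deriv (fun ξ => ∫ η, k (η - ξ) * φ η) = fun ξ => ∫ η, (-deriv k (η - ξ)) * φ η from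
    funext fun ξ => (K_hasDerivAt hk hφ hB ξ).deriv]
  exact K_deriv_cont hk hφ hB

lemma K_mono {k : ℝ → ℝ} (hk : H1 k) {φ ψ : ℝ → ℝ} (hφ : Measurable φ) {B : ℝ}
    (hB : ∀ x, |φ x| ≤ B) (hψ : Measurable ψ) {B' : ℝ} (hB' : ∀ x, |ψ x| ≤ B')
    (h : ∀ x, φ x ≤ ψ x) (ξ : ℝ) :
    ∫ η, k (η - ξ) * φ η ≤ ∫ η, k (η - ξ) * ψ η :=
  integral_mono (k_mul_int hk hφ hB ξ) (k_mul_int hk hψ hB' ξ)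
    fun η => mul_le_mul_of_nonneg_left (h η) (hk.2.1 _)

lemma K_const {k : ℝ → ℝ} (hk : H1 k) (a ξ : ℝ) : ∫ η, k (η - ξ) * a = a := by
  rw [integral_mul_const, k_one hk, one_mul]

/-- Resolvent of the transport operator. -/
def Sop (β c : ℝ) (g : ℝ → ℝ) (ξ : ℝ) : ℝ :=
  ∫ τ in Ioi (0:ℝ), Real.exp (-β * τ) * g (ξ + c * τ)

lemma S_int {β c : ℝ} (hβ : 0 < β) {g : ℝ → ℝ} (hg : Measurable g) {B : ℝ}
    (hB : ∀ x, |g x| ≤ B) (ξ : ℝ) :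
    IntegrableOn (fun τ => Real.exp (-β * τ) * g (ξ + c * τ)) (Ioi 0) :=
  (exp_neg_integrableOn_Ioi 0 hβ).mul_bdd (c := B)
    (hg.comp (by fun_prop : Measurable fun τ : ℝ => ξ + c * τ)).aestronglyMeasurable
    (ae_of_all _ fun τ => hB _)

lemma S_mono {β c : ℝ} (hβ : 0 < β) {g g' : ℝ → ℝ} (hg : Measurable g) {B : ℝ}
    (hB : ∀ x, |g x| ≤ B) (hg' : Measurable g') {B' : ℝ} (hB' : ∀ x, |g' x| ≤ B')
    (h : ∀ x, g x ≤ g' x) (ξ : ℝ) : Sop β c g ξ ≤ Sop β c g' ξ :=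
  integral_mono (S_int hβ hg hB ξ) (S_int hβ hg' hB' ξ)
    fun _ => mul_le_mul_of_nonneg_left (h _) (Real.exp_pos _).le

lemma S_const {β : ℝ} (c : ℝ) (hβ : 0 < β) (a ξ : ℝ) : Sop β c (fun _ => a) ξ = a / β := by
  unfold Sop
  rw [integral_mul_const, integral_exp_mul_Ioi (by linarith) 0]
  simp
  field_simp

lemma S_meas {β c : ℝ} {g : ℝ → ℝ} (hg : Measurable g) : Measurable (Sop β c g) := by
  have : Measurable (fun p : ℝ × ℝ => Real.exp (-β * p.2) * g (p.1 + c * p.2)) := by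
    have h2 := hg.comp (by fun_prop : Measurable fun p : ℝ × ℝ => p.1 + c * p.2)
    exact (by fun_prop : Measurable fun p : ℝ × ℝ => Real.exp (-β * p.2)).mul h2
  exact (this.stronglyMeasurable.integral_prod_right
    (ν := volume.restrict (Ioi (0:ℝ)))).measurable

lemma S_zero {β : ℝ} (hβ : 0 < β) (g : ℝ → ℝ) (ξ : ℝ) : Sop β 0 g ξ = g ξ / β := by
  have := S_const 0 hβ (g ξ) ξ
  simpa [Sop] using this

lemma S_formula {β c : ℝ} (hβ : 0 < β) (hc : 0 < c) {g : ℝ → ℝ} (hg : Measurable g) {B : ℝ}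
    (hB : ∀ x, |g x| ≤ B) (ξ : ℝ) :
    Sop β c g ξ = c⁻¹ * (Real.exp ((β / c) * ξ) *
      ((∫ s in Ioi (0:ℝ), Real.exp (-(β / c) * s) * g s)
        - ∫ s in (0:ℝ)..ξ, Real.exp (-(β / c) * s) * g s)) := by
  have hbc : 0 < β / c := by positivity
  have hI : ∀ a, IntegrableOn (fun s => Real.exp (-(β / c) * s) * g s) (Ioi a) := fun a =>
    (exp_neg_integrableOn_Ioi a hbc).mul_bdd (c := B) hg.aestronglyMeasurable
      (ae_of_all _ fun τ => hB _)
  have h1 : Sop β c g ξ = c⁻¹ * ∫ y in Ioi (0:ℝ), Real.exp (-(β / c) * y) * g (ξ + y) := by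
    have := integral_comp_mul_left_Ioi
      (fun y => Real.exp (-(β / c) * y) * g (ξ + y)) 0 hc
    rw [mul_zero, smul_eq_mul] at this
    rw [← this]
    unfold Sop
    congr 1
    ext τ
    congr 2
    field_simp
  have h2 : ∫ y in Ioi (0:ℝ), Real.exp (-(β / c) * y) * g (ξ + y)
      = Real.exp ((β / c) * ξ) * ∫ s in Ioi ξ, Real.exp (-(β / c) * s) * g s := by
    rw [← integral_const_mul, ← integral_indicator measurableSet_Ioi,
      ← integral_indicator measurableSet_Ioi]
    symm
    rw [← integral_add_right_eq_self _ ξ]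
    congr 1
    ext y
    by_cases hy : 0 < y
    · rw [indicator_of_mem (by simpa using hy), indicator_of_mem (by simpa using hy),
        ← mul_assoc, ← Real.exp_add]
      congr 2
      · ring
      · ring
    · rw [indicator_of_notMem (by simpa using hy), indicator_of_notMem (by simpa using hy)]
  have h3 := intervalIntegral.integral_interval_add_Ioi (hI 0) (hI ξ)
  rw [h1, h2, ← h3]
  ring

lemma S_ii {β c : ℝ} {g : ℝ → ℝ} (hg : Measurable g) {B : ℝ}
    (hB : ∀ x, |g x| ≤ B) (a b : ℝ) :
    IntervalIntegrable (fun s => Real.exp (-(β / c) * s) * g s) volume a b := by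
  have : IntervalIntegrable (fun s => Real.exp (-(β / c) * s)) volume a b :=
    Continuous.intervalIntegrable (by fun_prop) _ _
  rw [intervalIntegrable_iff] at this ⊢
  exact this.mul_bdd (c := B) hg.aestronglyMeasurable (ae_of_all _ fun τ => hB _)

lemma S_cont {β c : ℝ} (hβ : 0 < β) (hc : 0 < c) {g : ℝ → ℝ} (hg : Measurable g) {B : ℝ}
    (hB : ∀ x, |g x| ≤ B) : Continuous (Sop β c g) := by
  rw [show Sop β c g = _ from funext (S_formula hβ hc hg hB)]
  have := intervalIntegral.continuous_primitive (S_ii (β := β) (c := c) hg hB) 0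
  fun_prop

lemma S_deriv {β c : ℝ} (hβ : 0 < β) (hc : 0 < c) {g : ℝ → ℝ} (hg : Continuous g) {B : ℝ}
    (hB : ∀ x, |g x| ≤ B) (ξ : ℝ) :
    HasDerivAt (Sop β c g) ((β * Sop β c g ξ - g ξ) / c) ξ := by
  have hF := funext (S_formula hβ hc hg.measurable hB)
  have hcont : Continuous (fun s => Real.exp (-(β / c) * s) * g s) := by fun_prop
  have h1 := (hcont.integral_hasStrictDerivAt 0 ξ).hasDerivAt
  have h2 : HasDerivAt (fun ξ => Real.exp ((β / c) * ξ)) (Real.exp ((β / c) * ξ) * (β / c)) ξ := by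
    have := ((hasDerivAt_id ξ).const_mul (β / c)).exp
    simpa using this
  have h3 := (h2.mul (h1.const_sub
    (∫ s in Ioi (0:ℝ), Real.exp (-(β / c) * s) * g s))).const_mul c⁻¹
  have h4 : Real.exp ((β / c) * ξ) * Real.exp (-(β / c) * ξ) = 1 := by
    rw [← Real.exp_add]; simp
  rw [S_formula hβ hc hg.measurable hB ξ]
  rw [show Sop β c g = _ from hF]
  refine h3.congr_deriv ?_
  have h5 : Real.exp ((β / c) * ξ) * -(Real.exp (-(β / c) * ξ) * g ξ) = - g ξ := by
    linear_combination (-g ξ) * h4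
  rw [h5]
  field_simp
  ring

/-- subsolutions lie below the resolvent -/
lemma S_sub {β c : ℝ} (hβ : 0 < β) {u d g : ℝ → ℝ} {C : ℝ}
    (hu : ∀ x, HasDerivAt u (d x) x) (hub : ∀ x, |u x| ≤ C) (hd : Measurable d)
    {D : ℝ} (hD : ∀ x, |β * u x - c * d x| ≤ D) (hg : Measurable g) {B : ℝ}
    (hB : ∀ x, |g x| ≤ B) (h : ∀ x, β * u x - c * d x ≤ g x) (ξ : ℝ) :
    u ξ ≤ Sop β c g ξ := by
  have hum : Measurable u :=
    (continuous_iff_continuousAt.2 fun x => (hu x).continuousAt).measurable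
  have hm : Measurable (fun x => β * u x - c * d x) := by fun_prop
  have h1 : Sop β c (fun x => β * u x - c * d x) ξ = u ξ := by
    unfold Sop
    have := integral_Ioi_of_hasDerivAt_of_tendsto' (a := 0) (m := 0)
      (f := fun τ => -(Real.exp (-β * τ) * u (ξ + c * τ)))
      (f' := fun τ => Real.exp (-β * τ) * (β * u (ξ + c * τ) - c * d (ξ + c * τ)))
      ?_ (S_int hβ hm hD ξ) ?_
    · rw [this]; simp
    · intro τ _
      have e1 : HasDerivAt (fun τ => Real.exp (-β * τ)) (Real.exp (-β * τ) * (-β)) τ := by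
        have := ((hasDerivAt_id τ).const_mul (-β)).exp
        simpa using this
      have e2 : HasDerivAt (fun τ => ξ + c * τ) c τ := by
        simpa using ((hasDerivAt_id τ).const_mul c).const_add ξ
      have e3 := (e1.mul ((hu (ξ + c * τ)).comp τ e2)).neg
      refine e3.congr_deriv ?_
      simp only [Function.comp]
      ring
    · have e0 : Tendsto (fun τ : ℝ => Real.exp (-β * τ) * C) atTop (𝓝 0) := by
        have : Tendsto (fun τ : ℝ => Real.exp (-β * τ)) atTop (𝓝 0) := by
          apply Real.tendsto_exp_atBot.comp
          exact tendsto_id.const_mul_atTop_of_neg (by linarith)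
        simpa using this.mul_const C
      refine squeeze_zero_norm (fun τ => ?_) e0
      rw [norm_neg, norm_mul, Real.norm_eq_abs, Real.norm_eq_abs, Real.abs_exp]
      gcongr
      exact hub _
  rw [← h1]
  exact S_mono hβ hm hD hg hB h ξ

lemma fH2_bounds {r q L L0 : ℝ} {χ : ℝ → ℝ} (hχ : IsH2chi r q L L0 χ) (x : ℝ) :
    0 ≤ χ x ∧ χ x ≤ 1 := hχ.2.2.2.2.2.1 x

lemma char_deriv {c : ℝ} {k : ℝ → ℝ} {f : ℝ → ℝ → ℝ} {v vt vx : ℝ → ℝ → ℝ}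
    (h : IsClassicalSol c k f v vt vx) (a s : ℝ) (hs : 0 < s) :
    HasDerivAt (fun s => v s (a - c * s)) (vt s (a - c * s) - c * vx s (a - c * s)) s := by
  obtain ⟨-, -, hct, hcx, hdt, hdx, -⟩ := h
  have hnb : {p : ℝ × ℝ | 0 < p.1} ∈ 𝓝 (s, a - c * s) :=
    (isOpen_lt continuous_const continuous_fst).mem_nhds hs
  have hnb' : {p : ℝ × ℝ | 0 ≤ p.1} ∈ 𝓝 (s, a - c * s) :=
    Filter.mem_of_superset hnb fun p hp => le_of_lt (show (0:ℝ) < p.1 from hp)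
  have key := hasStrictFDerivAt_uncurry_coprod (𝕜 := ℝ) (u := (s, a - c * s)) (f := v)
    (f₁ := fun t x => ContinuousLinearMap.toSpanSingleton ℝ (vt t x))
    (f₂ := fun t x => ContinuousLinearMap.toSpanSingleton ℝ (vx t x)) ?_ ?_ ?_ ?_
  · have e2 : HasDerivAt (fun s => ((s, a - c * s) : ℝ × ℝ)) (1, -c) s := by
      refine (hasDerivAt_id s).prodMk ?_
      simpa using ((hasDerivAt_id s).const_mul c).const_sub a
    have e3 := key.hasFDerivAt.comp_hasDerivAt s e2
    refine (e3.congr_deriv ?_)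
    simp [Function.HasUncurry.uncurry]
    ring
  · filter_upwards [hnb] with p hp
    have : HasDerivAt (fun s => v s p.2) (vt p.1 p.2) p.1 :=
      (hdt p.1 p.2 (le_of_lt hp)).hasDerivAt (Ici_mem_nhds hp)
    exact this.hasFDerivAt
  · filter_upwards [hnb] with p hp
    exact (hdx p.1 p.2 (le_of_lt hp)).hasFDerivAt
  · exact (ContinuousLinearMap.toSpanSingletonCLE (𝕜 := ℝ) (E := ℝ)).continuous.continuousAt.comp
      (hct.continuousAt hnb')
  · exact (ContinuousLinearMap.toSpanSingletonCLE (𝕜 := ℝ) (E := ℝ)).continuous.continuousAt.comp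
      (hcx.continuousAt hnb')

lemma compare_step {k : ℝ → ℝ} (hk : H1 k)
    {r q L L0 : ℝ} {χ : ℝ → ℝ} (hχ : IsH2chi r q L L0 χ) {c : ℝ}
    {u d : ℝ → ℝ} (hu : ∀ x, HasDerivAt u (d x) x) (hpos : ∀ x, 0 < u x) {U : ℝ}
    (hU : ∀ x, u x ≤ U)
    (hsub : ∀ ξ, 0 ≤ c * d ξ + ((∫ η, k (η - ξ) * u η) - u ξ) + fH2 r q χ ξ (u ξ) * u ξ)
    {v vt vx : ℝ → ℝ → ℝ} (hv : IsClassicalSol c k (fH2 r q χ) v vt vx)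
    (h0 : ∀ ξ, v 0 ξ = u ξ) {C : ℝ} (hC : ∀ t ξ, 0 ≤ t → |v t ξ| ≤ C) {B : ℝ}
    (hB : B = 1 + q + r + r * (C + U)) {m : ℝ} (hm : 0 ≤ m)
    (H : ∀ t ξ, 0 ≤ t → -(m * Real.exp ((2 + 3 * B) * t)) ≤ v t ξ - u ξ) :
    ∀ t ξ, 0 ≤ t → -(m / 2 * Real.exp ((2 + 3 * B) * t)) ≤ v t ξ - u ξ := by
  intro t ξ ht
  have hr : 0 < r := hχ.1
  have hq : 0 < q := hχ.2.1
  have hC0 : 0 ≤ C := (abs_nonneg _).trans (hC 0 0 le_rfl)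
  have hU0 : 0 ≤ U := (hpos 0).le.trans (hU 0)
  have hB1 : 0 ≤ B := by rw [hB]; positivity
  have huc : Continuous u := continuous_iff_continuousAt.2 fun x => (hu x).continuousAt
  have huU : ∀ x, |u x| ≤ U := fun x => by rw [abs_of_pos (hpos x)]; exact hU x
  set a := ξ + c * t with ha
  set h : ℝ → ℝ := fun s => Real.exp (B * s) * (v s (a - c * s) - u (a - c * s))
    + m / 2 * Real.exp (2 * (1 + 2 * B) * s) with hh
  have hvc := hv.2.1
  have hcont : ContinuousOn h (Icc 0 t) := by
    have e1 : ContinuousOn (fun s : ℝ => v s (a - c * s)) (Icc 0 t) := by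
      have := hvc.comp (f := fun s : ℝ => (s, a - c * s)) (s := Icc 0 t)
        (by fun_prop) (fun s hs => hs.1)
      exact this
    have e2 : Continuous (fun s : ℝ => u (a - c * s)) := by fun_prop
    exact ((by fun_prop : Continuous fun s : ℝ => Real.exp (B * s)).continuousOn.mul
      (e1.sub e2.continuousOn)).add
      (by fun_prop : Continuous fun s : ℝ => m / 2 * Real.exp (2 * (1 + 2 * B) * s)).continuousOn
  have hder : ∀ s, 0 < s → ∃ h', HasDerivAt h h' s ∧ 0 ≤ h' := by
    intro s hs
    set x := a - c * s with hx
    have e1 := char_deriv hv a s hs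
    have e2 : HasDerivAt (fun s => a - c * s) (-c) s := by
      simpa using ((hasDerivAt_id s).const_mul c).const_sub a
    have e3 := (hu (a - c * s)).comp s e2
    have e4 : HasDerivAt (fun s => Real.exp (B * s)) (Real.exp (B * s) * B) s := by
      simpa using ((hasDerivAt_id s).const_mul B).exp
    have e5 : HasDerivAt (fun s => Real.exp (2 * (1 + 2 * B) * s))
        (Real.exp (2 * (1 + 2 * B) * s) * (2 * (1 + 2 * B))) s := by
      simpa using ((hasDerivAt_id s).const_mul (2 * (1 + 2 * B))).exp
    refine ⟨_, (e4.mul (e1.sub e3)).add (e5.const_mul (m / 2)), ?_⟩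
    simp only [Function.comp, Pi.sub_apply, ← hx]
    have hpde := hv.2.2.2.2.2.2 s x hs.le
    have hvm : Measurable (v s) :=
      (continuous_iff_continuousAt.2 fun y => (hv.2.2.2.2.2.1 s y hs.le).continuousAt).measurable
    have hvC : ∀ y, |v s y| ≤ C := fun y => hC s y hs.le
    set E := Real.exp ((2 + 3 * B) * s) with hE
    have hEpos : 0 < E := Real.exp_pos _
    have hK : -(m * E) ≤ (∫ η, k (η - x) * v s η) - ∫ η, k (η - x) * u η := by
      rw [← integral_sub (k_mul_int hk hvm hvC x) (k_mul_int hk huc.measurable huU x)]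
      rw [← K_const hk (-(m * E)) x]
      refine integral_mono ((k_int_shift hk x).mul_const _)
        ((k_mul_int hk hvm hvC x).sub (k_mul_int hk huc.measurable huU x)) fun η => ?_
      simp only
      rw [← mul_sub]
      exact mul_le_mul_of_nonneg_left (H s η hs.le) (hk.2.1 _)
    have hw := H s x hs.le
    rw [← hE] at hw
    have hs' := hsub x
    set w := v s x - u x with hwdef
    set b := -1 - q + (r + q) * χ x - r * χ x * (u x + v s x) with hb
    obtain ⟨hχ0, hχ1⟩ := fH2_bounds hχ x
    have hbB : |b| ≤ B := by
      have g1 : |v s x| ≤ C := hvC x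
      have g2 := huU x
      have g3 : |u x + v s x| ≤ C + U := (abs_add_le _ _).trans (by linarith)
      have g4 : |r * χ x * (u x + v s x)| ≤ r * (C + U) := by
        rw [abs_mul, abs_of_nonneg (by positivity : 0 ≤ r * χ x)]
        have : r * χ x ≤ r := by nlinarith
        have := abs_nonneg (u x + v s x)
        nlinarith
      rw [abs_le] at g4
      have g5 : 0 ≤ (r + q) * χ x := by positivity
      have g6 : (r + q) * χ x ≤ r + q := by nlinarith
      rw [hb, hB, abs_le]
      constructor <;> linarith [g4.1, g4.2]
    obtain ⟨hb1, hb2⟩ := abs_le.1 hbB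
    have hmE : 0 ≤ m * E := by positivity
    have hbw : -(2 * B * (m * E)) ≤ (b + B) * w := by nlinarith
    have hmain : -((1 + 2 * B) * (m * E)) ≤ B * w + (vt s x - c * vx s x - d x * -c) := by
      have : fH2 r q χ x (v s x) * v s x - v s x - (fH2 r q χ x (u x) * u x - u x) = b * w := by
        simp only [fH2, hb, hwdef]; ring
      rw [hpde]
      nlinarith
    have hEE : Real.exp (2 * (1 + 2 * B) * s) = Real.exp (B * s) * E := by
      rw [hE, ← Real.exp_add]; congr 1; ring
    rw [hEE]
    have := mul_le_mul_of_nonneg_left hmain (Real.exp_pos (B * s)).le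
    nlinarith
  have hmono : MonotoneOn h (Icc 0 t) := by
    apply monotoneOn_of_deriv_nonneg (convex_Icc 0 t) hcont
    · intro s hs
      rw [interior_Icc] at hs
      obtain ⟨h', h1, _⟩ := hder s hs.1
      exact h1.differentiableAt.differentiableWithinAt
    · intro s hs
      rw [interior_Icc] at hs
      obtain ⟨h', h1, h2⟩ := hder s hs.1
      rw [h1.deriv]; exact h2
  have h3 := hmono (left_mem_Icc.2 ht) (right_mem_Icc.2 ht) ht
  have hxt : a - c * t = ξ := by rw [ha]; ring
  have hEE : Real.exp (2 * (1 + 2 * B) * t) = Real.exp (B * t) * Real.exp ((2 + 3 * B) * t) := by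
    rw [← Real.exp_add]; congr 1; ring
  simp only [hh, mul_zero, sub_zero, h0, sub_self, Real.exp_zero, hxt, hEE] at h3
  have hp := Real.exp_pos (B * t)
  have : 0 ≤ Real.exp (B * t) * (v t ξ - u ξ + m / 2 * Real.exp ((2 + 3 * B) * t)) := by
    nlinarith
  have := nonneg_of_mul_nonneg_right this hp
  linarith

lemma compare {k : ℝ → ℝ} (hk : H1 k)
    {r q L L0 : ℝ} {χ : ℝ → ℝ} (hχ : IsH2chi r q L L0 χ) {c : ℝ}
    {u d : ℝ → ℝ} (hu : ∀ x, HasDerivAt u (d x) x) (hpos : ∀ x, 0 < u x) {U : ℝ}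
    (hU : ∀ x, u x ≤ U)
    (hsub : ∀ ξ, 0 ≤ c * d ξ + ((∫ η, k (η - ξ) * u η) - u ξ) + fH2 r q χ ξ (u ξ) * u ξ)
    {v vt vx : ℝ → ℝ → ℝ} (hv : IsClassicalSol c k (fH2 r q χ) v vt vx)
    (h0 : ∀ ξ, v 0 ξ = u ξ) (t ξ : ℝ) (ht : 0 ≤ t) : u ξ ≤ v t ξ := by
  obtain ⟨C, hC⟩ := hv.1
  have hr : 0 < r := hχ.1
  have hq : 0 < q := hχ.2.1
  have hC0 : 0 ≤ C := (abs_nonneg _).trans (hC 0 0 le_rfl)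
  have hU0 : 0 ≤ U := (hpos 0).le.trans (hU 0)
  obtain ⟨B, hB⟩ : ∃ B, B = 1 + q + r + r * (C + U) := ⟨_, rfl⟩
  have hB1 : 0 ≤ B := by rw [hB]; positivity
  have key : ∀ n : ℕ, ∀ t ξ, 0 ≤ t →
      -((C + U) * (1 / 2) ^ n * Real.exp ((2 + 3 * B) * t)) ≤ v t ξ - u ξ := by
    intro n
    induction n with
    | zero =>
      intro t ξ ht
      have h1 := (abs_le.1 (hC t ξ ht)).1
      have h2 := hU ξ
      have h3 : 1 ≤ Real.exp ((2 + 3 * B) * t) := Real.one_le_exp (by positivity)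
      have : (C + U) * 1 ≤ (C + U) * Real.exp ((2 + 3 * B) * t) := by gcongr
      simp only [pow_zero]
      linarith
    | succ n ih =>
      intro t ξ ht
      have := compare_step hk hχ hu hpos hU hsub hv h0 hC hB (by positivity) ih t ξ ht
      convert this using 3
      ring
  have hlim : Tendsto (fun n : ℕ => -((C + U) * (1 / 2 : ℝ) ^ n * Real.exp ((2 + 3 * B) * t)))
      atTop (𝓝 0) := by
    have := tendsto_pow_atTop_nhds_zero_of_lt_one (r := (1 / 2 : ℝ)) (by norm_num) (by norm_num)
    simpa using ((this.const_mul (C + U)).mul_const (Real.exp ((2 + 3 * B) * t))).neg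
  have := le_of_tendsto' hlim fun n => key n t ξ ht
  linarith

/-- The monotone nonlinearity. -/
def Gop (k : ℝ → ℝ) (r q : ℝ) (χ : ℝ → ℝ) (u : ℝ → ℝ) (x : ℝ) : ℝ :=
  (∫ η, k (η - x) * u η) + ((2 * r + (r + q) * χ x) * u x - r * χ x * u x ^ 2)

/-- Admissible functions. -/
def Adm (u : ℝ → ℝ) : Prop := Measurable u ∧ ∀ x, 0 ≤ u x ∧ u x ≤ 1

lemma Adm.abs_le {u : ℝ → ℝ} (h : Adm u) (x : ℝ) : |u x| ≤ 1 := by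
  rw [abs_of_nonneg (h.2 x).1]; exact (h.2 x).2

lemma Gop_eq (k : ℝ → ℝ) (r q : ℝ) (χ : ℝ → ℝ) (u : ℝ → ℝ) (x : ℝ) :
    Gop k r q χ u x = ((∫ η, k (η - x) * u η) - u x) + fH2 r q χ x (u x) * u x
      + (1 + q + 2 * r) * u x := by
  simp only [Gop, fH2]; ring

lemma G_mono {k : ℝ → ℝ} (hk : H1 k)
    {r q L L0 : ℝ} {χ : ℝ → ℝ} (hχ : IsH2chi r q L L0 χ) {u w : ℝ → ℝ} (hu : Adm u) (hw : Adm w)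
    (h : ∀ x, u x ≤ w x) (x : ℝ) : Gop k r q χ u x ≤ Gop k r q χ w x := by
  have h1 := K_mono hk hu.1 hu.abs_le hw.1 hw.abs_le h x
  obtain ⟨c0, c1⟩ := fH2_bounds hχ x
  have hr : 0 < r := hχ.1
  have hq : 0 < q := hχ.2.1
  have h2 := h x
  obtain ⟨u0, u1⟩ := hu.2 x
  obtain ⟨w0, w1⟩ := hw.2 x
  have h3 : 0 ≤ (w x - u x) * (2 * r + (r + q) * χ x - r * χ x * (u x + w x)) := by
    apply mul_nonneg (by linarith)
    have a1 : r * χ x * (u x + w x) ≤ r * 1 * 2 := by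
      gcongr; linarith
    have : 0 ≤ (r + q) * χ x := by positivity
    linarith
  unfold Gop
  nlinarith

lemma adm_zero : Adm (fun _ => 0) := ⟨measurable_const, fun _ => by norm_num⟩
lemma adm_one : Adm (fun _ => 1) := ⟨measurable_const, fun _ => by norm_num⟩

lemma G_bd {k : ℝ → ℝ} (hk : H1 k)
    {r q L L0 : ℝ} {χ : ℝ → ℝ} (hχ : IsH2chi r q L L0 χ) {u : ℝ → ℝ} (hu : Adm u) (x : ℝ) :
    0 ≤ Gop k r q χ u x ∧ Gop k r q χ u x ≤ 1 + q + 2 * r := by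
  have h0 := G_mono hk hχ adm_zero hu (fun x => (hu.2 x).1) x
  have h1 := G_mono hk hχ hu adm_one (fun x => (hu.2 x).2) x
  obtain ⟨c0, c1⟩ := fH2_bounds hχ x
  have hr : 0 < r := hχ.1
  have hq : 0 < q := hχ.2.1
  constructor
  · refine le_trans (le_of_eq ?_) h0
    simp [Gop]
  · refine h1.trans ?_
    simp only [Gop]
    rw [K_const hk]
    nlinarith

lemma G_abs {k : ℝ → ℝ} (hk : H1 k)
    {r q L L0 : ℝ} {χ : ℝ → ℝ} (hχ : IsH2chi r q L L0 χ) {u : ℝ → ℝ} (hu : Adm u) (x : ℝ) :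
    |Gop k r q χ u x| ≤ 1 + q + 2 * r := by
  obtain ⟨h0, h1⟩ := G_bd hk hχ hu x
  rw [abs_of_nonneg h0]; exact h1

lemma G_meas {k : ℝ → ℝ} (hk : H1 k)
    {r q L L0 : ℝ} {χ : ℝ → ℝ} (hχ : IsH2chi r q L L0 χ) {u : ℝ → ℝ} (hu : Adm u) :
    Measurable (Gop k r q χ u) := by
  have h1 : Measurable (fun ξ => ∫ η, k (η - ξ) * u η) :=
    (K_contDiff hk hu.1 hu.abs_le).continuous.measurable
  have h2 : Measurable χ := hχ.2.2.2.2.1.continuous.measurable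
  have h3 := hu.1
  unfold Gop
  fun_prop

lemma G_cont {k : ℝ → ℝ} (hk : H1 k)
    {r q L L0 : ℝ} {χ : ℝ → ℝ} (hχ : IsH2chi r q L L0 χ) {u : ℝ → ℝ} (hu : Adm u)
    (huc : Continuous u) : Continuous (Gop k r q χ u) := by
  have h1 : Continuous (fun ξ => ∫ η, k (η - ξ) * u η) :=
    (K_contDiff hk hu.1 hu.abs_le).continuous
  have h2 : Continuous χ := hχ.2.2.2.2.1.continuous
  unfold Gop
  fun_prop

lemma T_adm {k : ℝ → ℝ} (hk : H1 k)
    {r q L L0 : ℝ} {χ : ℝ → ℝ} (hχ : IsH2chi r q L L0 χ) (c : ℝ) {u : ℝ → ℝ} (hu : Adm u) :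
    Adm (Sop (1 + q + 2 * r) c (Gop k r q χ u)) := by
  have hr : 0 < r := hχ.1
  have hq : 0 < q := hχ.2.1
  have hβ : 0 < 1 + q + 2 * r := by positivity
  have hb := G_abs hk hχ hu
  refine ⟨S_meas (G_meas hk hχ hu), fun x => ⟨?_, ?_⟩⟩
  · have := S_mono (c := c) hβ (g := fun _ => 0) measurable_const (B := 0) (by simp)
      (G_meas hk hχ hu) hb (fun y => (G_bd hk hχ hu y).1) x
    rw [S_const c hβ] at this
    simpa using this
  · have := S_mono (c := c) hβ (g' := fun _ => 1 + q + 2 * r) (G_meas hk hχ hu) hb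
      measurable_const (B' := 1 + q + 2 * r) (fun _ => (abs_of_pos hβ).le)
      (fun y => (G_bd hk hχ hu y).2) x
    rw [S_const c hβ, div_self hβ.ne'] at this
    exact this

lemma exists_fix {k : ℝ → ℝ} (hk : H1 k)
    {r q L L0 : ℝ} {χ : ℝ → ℝ} (hχ : IsH2chi r q L L0 χ) (c : ℝ) {u : ℝ → ℝ} (hu : Adm u)
    (hsub : ∀ x, u x ≤ Sop (1 + q + 2 * r) c (Gop k r q χ u) x) :
    ∃ Φ, Adm Φ ∧ (∀ x, u x ≤ Φ x) ∧ ∀ x, Φ x = Sop (1 + q + 2 * r) c (Gop k r q χ Φ) x := by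
  have hr : 0 < r := hχ.1
  have hq : 0 < q := hχ.2.1
  have hβ : 0 < 1 + q + 2 * r := by positivity
  set T : (ℝ → ℝ) → (ℝ → ℝ) := fun w => Sop (1 + q + 2 * r) c (Gop k r q χ w) with hT
  set U : ℕ → ℝ → ℝ := fun n => T^[n] u with hUdef
  have hU0 : U 0 = u := rfl
  have hUs : ∀ n, U (n + 1) = T (U n) := fun n => Function.iterate_succ_apply' T n u
  have hA : ∀ n, Adm (U n) := by
    intro n
    induction n with
    | zero => exact hu
    | succ n ih => rw [hUs]; exact T_adm hk hχ c ih
  have hstep : ∀ n x, U n x ≤ U (n + 1) x := by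
    intro n
    induction n with
    | zero => intro x; rw [hUs, hU0]; exact hsub x
    | succ n ih =>
      intro x
      rw [hUs (n + 1)]
      conv_lhs => rw [hUs n]
      exact S_mono hβ (G_meas hk hχ (hA n)) (G_abs hk hχ (hA n)) (G_meas hk hχ (hA (n + 1)))
        (G_abs hk hχ (hA (n + 1))) (G_mono hk hχ (hA n) (hA (n + 1)) ih) x
  have hmono : ∀ x, Monotone fun n => U n x := fun x => monotone_nat_of_le_succ fun n => hstep n x
  have hbdd : ∀ x, BddAbove (range fun n => U n x) := fun x =>
    ⟨1, by rintro _ ⟨n, rfl⟩; exact ((hA n).2 x).2⟩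
  set Φ : ℝ → ℝ := fun x => ⨆ n, U n x with hΦ
  have hlim : ∀ x, Tendsto (fun n => U n x) atTop (𝓝 (Φ x)) := fun x =>
    tendsto_atTop_ciSup (hmono x) (hbdd x)
  have hle : ∀ x, u x ≤ Φ x := fun x => le_ciSup (hbdd x) 0
  have hΦA : Adm Φ := by
    refine ⟨measurable_of_tendsto_metrizable (fun n => (hA n).1) (tendsto_pi_nhds.2 hlim),
      fun x => ⟨(hu.2 x).1.trans (hle x), ciSup_le fun n => ((hA n).2 x).2⟩⟩
  have hG : ∀ x, Tendsto (fun n => Gop k r q χ (U n) x) atTop (𝓝 (Gop k r q χ Φ x)) := by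
    intro x
    have h1 : Tendsto (fun n => ∫ η, k (η - x) * U n η) atTop (𝓝 (∫ η, k (η - x) * Φ η)) := by
      refine tendsto_integral_of_dominated_convergence (fun η => k (η - x)) (fun n =>
        (k_mul_int hk (hA n).1 (hA n).abs_le x).aestronglyMeasurable) (k_int_shift hk x)
        (fun n => ae_of_all _ fun η => ?_) (ae_of_all _ fun η => (hlim η).const_mul _)
      rw [norm_mul, Real.norm_eq_abs, Real.norm_eq_abs, abs_of_nonneg (hk.2.1 _)]
      exact mul_le_of_le_one_right (hk.2.1 _) ((hA n).abs_le η)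
    exact h1.add (((hlim x).const_mul _).sub (((hlim x).pow 2).const_mul _))
  refine ⟨Φ, hΦA, hle, fun x => ?_⟩
  have h2 : Tendsto (fun n => T (U n) x) atTop (𝓝 (T Φ x)) := by
    refine tendsto_integral_of_dominated_convergence
      (fun τ => Real.exp (-(1 + q + 2 * r) * τ) * (1 + q + 2 * r)) (fun n =>
        (S_int hβ (G_meas hk hχ (hA n)) (G_abs hk hχ (hA n)) x).aestronglyMeasurable)
      ((exp_neg_integrableOn_Ioi 0 hβ).mul_const _)
      (fun n => ae_of_all _ fun τ => ?_) (ae_of_all _ fun τ => (hG _).const_mul _)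
    rw [norm_mul, Real.norm_eq_abs, Real.norm_eq_abs, Real.abs_exp]
    gcongr
    exact G_abs hk hχ (hA n) _
  have h3 : Tendsto (fun n => U (n + 1) x) atTop (𝓝 (Φ x)) :=
    (hlim x).comp (tendsto_add_atTop_nat 1)
  simp only [hUs] at h3
  exact tendsto_nhds_unique h3 h2

lemma exists_TW {k : ℝ → ℝ} (hk : H1 k)
    {r q L L0 : ℝ} {χ : ℝ → ℝ} (hχ : IsH2chi r q L L0 χ) {c : ℝ} (hc : 0 ≤ c)
    {u d : ℝ → ℝ} (hu : ∀ x, HasDerivAt u (d x) x) (hpos : ∀ x, 0 < u x)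
    (hU : ∀ x, u x ≤ 1) (hd : Measurable d) {D : ℝ} (hD : ∀ x, |c * d x| ≤ D)
    (hsub : ∀ ξ, 0 ≤ c * d ξ + ((∫ η, k (η - ξ) * u η) - u ξ) + fH2 r q χ ξ (u ξ) * u ξ) :
    ∃ Φ, IsTW c k (fH2 r q χ) Φ := by
  have hr : 0 < r := hχ.1
  have hq : 0 < q := hχ.2.1
  have hβ : 0 < 1 + q + 2 * r := by positivity
  have huc : Continuous u := continuous_iff_continuousAt.2 fun x => (hu x).continuousAt
  have hA : Adm u := ⟨huc.measurable, fun x => ⟨(hpos x).le, hU x⟩⟩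
  obtain ⟨Φ, hΦ, hle, hfix⟩ := exists_fix hk hχ c hA (fun x => by
    refine S_sub hβ hu hA.abs_le hd (D := (1 + q + 2 * r) + D) ?_ (G_meas hk hχ hA)
      (G_abs hk hχ hA) ?_ x
    · intro y
      refine (abs_sub _ _).trans ?_
      rw [abs_mul, abs_of_pos hβ]
      have := hA.abs_le y
      have := hD y
      nlinarith
    · intro y
      rw [Gop_eq]
      have := hsub y
      linarith)
  have hΦpos : ∀ x, 0 < Φ x := fun x => (hpos x).trans_le (hle x)
  have hfix' : Φ = Sop (1 + q + 2 * r) c (Gop k r q χ Φ) := funext hfix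
  rcases hc.eq_or_lt with rfl | hc
  · have hKC := K_contDiff hk hΦ.1 hΦ.abs_le
    have hχC : ContDiff ℝ 1 χ := hχ.2.2.2.2.1
    have heq : ∀ x, ((∫ η, k (η - x) * Φ η) - Φ x) + fH2 r q χ x (Φ x) * Φ x = 0 := by
      intro x
      have h1 := hfix x
      rw [S_zero hβ, Gop_eq, eq_div_iff hβ.ne'] at h1
      linarith
    refine ⟨Φ, ?_, hΦpos, ⟨1, fun x => (hΦ.2 x).2⟩, fun x => by rw [zero_mul, zero_add, heq]⟩
    set W : ℝ → ℝ := fun ξ => ∫ η, k (η - ξ) * Φ η with hW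
    have hWpos : ∀ x, 0 < W x := by
      intro x
      have hnn : 0 ≤ fun η => k (η - x) * Φ η := fun η => mul_nonneg (hk.2.1 _) (hΦpos η).le
      refine lt_of_le_of_ne (integral_nonneg hnn) fun h0 => ?_
      have h1 := (integral_eq_zero_iff_of_nonneg hnn (k_mul_int hk hΦ.1 hΦ.abs_le x)).1 h0.symm
      have h2 : (fun η => k (η - x)) =ᵐ[volume] 0 := by
        filter_upwards [h1] with η hη
        exact (mul_eq_zero.1 hη).resolve_right (hΦpos η).ne'
      have h3 := integral_congr_ae h2
      rw [k_one hk] at h3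
      simp at h3
    set b : ℝ → ℝ := fun x => 1 + q - (r + q) * χ x with hb
    have hquad : ∀ x, r * χ x * Φ x ^ 2 + b x * Φ x = W x := by
      intro x
      have := heq x
      simp only [fH2] at this
      simp only [hb, hW]
      linarith
    have hfac : ∀ x, b x + r * χ x * Φ x = W x / Φ x := by
      intro x
      rw [eq_div_iff (hΦpos x).ne', ← hquad x]; ring
    have hpos2 : ∀ x, 0 < b x + r * χ x * Φ x := fun x => by
      rw [hfac x]; exact div_pos (hWpos x) (hΦpos x)
    have hpos3 : ∀ x, 0 < b x + 2 * (r * χ x) * Φ x := fun x => by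
      have h1 := hpos2 x
      have h2 : 0 ≤ r * χ x * Φ x :=
        mul_nonneg (mul_nonneg hr.le (fH2_bounds hχ x).1) (hΦpos x).le
      linarith
    have hdisc : ∀ x, b x ^ 2 + 4 * (r * χ x) * W x = (b x + 2 * (r * χ x) * Φ x) ^ 2 := by
      intro x
      rw [← hquad x]; ring
    have hsq : ∀ x, √(b x ^ 2 + 4 * (r * χ x) * W x) = b x + 2 * (r * χ x) * Φ x := by
      intro x
      rw [hdisc, Real.sqrt_sq (hpos3 x).le]
    have hform : Φ = fun x => 2 * W x / (b x + √(b x ^ 2 + 4 * (r * χ x) * W x)) := by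
      funext x
      rw [hsq]
      have h1 := hpos2 x
      rw [eq_div_iff (by linarith), ← hquad x]
      ring
    have hbC : ContDiff ℝ 1 b := by fun_prop
    have hdC : ContDiff ℝ 1 (fun x => b x ^ 2 + 4 * (r * χ x) * W x) := by fun_prop
    rw [hform]
    refine ContDiff.div (by fun_prop) (hbC.add (hdC.sqrt fun x => ?_)) fun x => ?_
    · rw [hdisc]; exact (pow_pos (hpos3 x) 2).ne'
    · rw [hsq]; have := hpos2 x; intro h; linarith
  · have hΦc : Continuous Φ := by
      rw [hfix']
      exact S_cont hβ hc (G_meas hk hχ hΦ) (G_abs hk hχ hΦ)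
    have hGc := G_cont hk hχ hΦ hΦc
    have hder : ∀ x, HasDerivAt Φ (((1 + q + 2 * r) * Φ x - Gop k r q χ Φ x) / c) x := by
      intro x
      have := S_deriv hβ hc hGc (G_abs hk hχ hΦ) x
      rw [← hfix'] at this
      exact this
    refine ⟨Φ, ?_, hΦpos, ⟨1, fun x => (hΦ.2 x).2⟩, fun x => ?_⟩
    · rw [contDiff_one_iff_deriv]
      refine ⟨fun x => (hder x).differentiableAt, ?_⟩
      rw [show deriv Φ = _ from funext fun x => (hder x).deriv]
      fun_prop
    · rw [(hder x).deriv, mul_div_cancel₀ _ hc.ne', Gop_eq]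
      ring

/-- Persistence when the principal eigenvalue is positive. -/
theorem persistence_of_positive_principal_eigenvalue
    (k : ℝ → ℝ) (hk : H1 k)
    (r q L L0 : ℝ) (χ : ℝ → ℝ) (hχ : IsH2chi r q L L0 χ)
    (c : ℝ) (hc : 0 ≤ c)
    (lam : ℝ) (hlam : 0 < lam) (φ : ℝ → ℝ)
    (hφC : ContDiff ℝ 1 φ) (hφpos : ∀ ξ, 0 < φ ξ) (hφbd : ∃ C, ∀ ξ, φ ξ ≤ C)
    (heig : ∀ ξ,
      c * deriv φ ξ + ((∫ η, k (η - ξ) * φ η) - φ ξ) + fH2 r q χ ξ 0 * φ ξ = lam * φ ξ) :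
    (∃ Φ, IsTW c k (fH2 r q χ) Φ) ∧
    ∃ α₀ : ℝ, 0 < α₀ ∧ ∀ α : ℝ, 0 < α → α ≤ α₀ →
      ∀ v vt vx, IsClassicalSol c k (fH2 r q χ) v vt vx → (∀ ξ, v 0 ξ = α * φ ξ) →
        ∀ t ξ, 0 ≤ t → α * φ ξ ≤ v t ξ := by
  have hr : 0 < r := hχ.1
  have hq : 0 < q := hχ.2.1
  obtain ⟨C, hC⟩ := hφbd
  have hC0 : 0 < C := (hφpos 0).trans_le (hC 0)
  have hφd : ∀ x, HasDerivAt φ (deriv φ x) x := fun x =>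
    ((hφC.differentiable one_ne_zero) x).hasDerivAt
  have hφm : Measurable φ := hφC.continuous.measurable
  have hφabs : ∀ x, |φ x| ≤ C := fun x => by rw [abs_of_pos (hφpos x)]; exact hC x
  have hud : ∀ α x, HasDerivAt (fun x => α * φ x) (α * deriv φ x) x := fun α x =>
    (hφd x).const_mul α
  have hsub : ∀ α : ℝ, 0 < α → α ≤ lam / (r * C) → ∀ ξ,
      0 ≤ c * (α * deriv φ ξ) + ((∫ η, k (η - ξ) * (α * φ η)) - α * φ ξ)
        + fH2 r q χ ξ (α * φ ξ) * (α * φ ξ) := by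
    intro α hα hα' ξ
    have hK : ∫ η, k (η - ξ) * (α * φ η) = α * ∫ η, k (η - ξ) * φ η := by
      rw [← integral_const_mul]
      congr 1
      ext η
      ring
    rw [hK]
    have he := heig ξ
    simp only [fH2] at he ⊢
    obtain ⟨c0, c1⟩ := fH2_bounds hχ ξ
    rw [le_div_iff₀ (by positivity)] at hα'
    have hp := hφpos ξ
    have h1 : r * χ ξ * (α * φ ξ) ≤ lam := by
      calc r * χ ξ * (α * φ ξ) ≤ r * 1 * (α * C) := by
            gcongr
            exact hC ξ
        _ ≤ lam := by linarith
    have h2 : 0 ≤ α * φ ξ * (lam - r * χ ξ * (α * φ ξ)) :=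
      mul_nonneg (by positivity) (by linarith)
    have h3 : c * (α * deriv φ ξ) + (α * (∫ η, k (η - ξ) * φ η) - α * φ ξ)
        + (-q + (r * (1 - α * φ ξ) + q) * χ ξ) * (α * φ ξ)
        = α * φ ξ * (lam - r * χ ξ * (α * φ ξ)) := by
      linear_combination α * he
    rw [h3]; exact h2
  constructor
  · obtain ⟨α, hα⟩ : ∃ α, α = min (lam / (r * C)) (1 / C) := ⟨_, rfl⟩
    have hα0 : 0 < α := by rw [hα]; exact lt_min (by positivity) (by positivity)
    have hα1 : α ≤ lam / (r * C) := by rw [hα]; exact min_le_left _ _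
    have hα2 : α * C ≤ 1 := by
      rw [← le_div_iff₀ hC0, hα]; exact min_le_right _ _
    refine exists_TW hk hχ hc (hud α) (fun x => mul_pos hα0 (hφpos x))
      (fun x => (mul_le_mul_of_nonneg_left (hC x) hα0.le).trans hα2)
      ((hφC.continuous_deriv le_rfl).measurable.const_mul α)
      (D := α * (lam * C + C + C + (q + (r + q)) * C)) (fun x => ?_) (hsub α hα0 hα1)
    have he := heig x
    simp only [fH2] at he
    obtain ⟨c0, c1⟩ := fH2_bounds hχ x
    have hp := hφpos x
    have hCx := hC x
    have hKb : 0 ≤ ∫ η, k (η - x) * φ η :=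
      integral_nonneg fun η => mul_nonneg (hk.2.1 _) (hφpos η).le
    have hKb' : ∫ η, k (η - x) * φ η ≤ C := by
      have := K_mono hk hφm hφabs (measurable_const (a := C)) (B' := C)
        (fun _ => (abs_of_pos hC0).le) hC x
      rwa [K_const hk] at this
    have hz : c * (α * deriv φ x) = α * (c * deriv φ x) := by ring
    rw [hz, abs_mul, abs_of_pos hα0]
    gcongr
    have h1 : lam * φ x ≤ lam * C := by gcongr
    have h2 : 0 ≤ lam * φ x := by positivity
    have h3 : q * φ x ≤ q * C := by gcongr
    have h4 : 0 ≤ q * φ x := by positivity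
    have h5 : (r + q) * χ x * φ x ≤ (r + q) * 1 * C := by gcongr
    have h6 : 0 ≤ (r + q) * χ x * φ x := by positivity
    rw [abs_le]
    constructor <;> nlinarith
  · refine ⟨lam / (r * C), by positivity, fun α hα0 hα1 v vt vx hv h0 t ξ ht => ?_⟩
    exact compare hk hχ (hud α) (fun x => mul_pos hα0 (hφpos x)) (U := α * C)
      (fun x => mul_le_mul_of_nonneg_left (hC x) hα0.le) (hsub α hα0 hα1) hv h0 t ξ ht
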